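/- arXiv:1711.02663 — 2 statements merged into one kernel-verified Lean document; each statement's English description precedes it below -/
import Mathlib

section
/- For any f ∈ H↑, the quotient set S_f has exactly one element if and only if there exist M > 0 and ε > 0 such that for all but finitely many n ∈ ω we have f(n + ⌊ε·f(n)⌋)/f(n) ≤ M. -/
open Filter

/-- `cnt A n` is the cardinality of `A ∩ {0, …, n-1}`. -/
noncomputable def cnt (A : Set ℕ) (n : ℕ) : ℕ := (A ∩ Set.Iio n).ncard

/-- `G` : functions `g : ω → (0,∞)` with `g n → ∞` and `n / g n` not tending to `0`. -/
def inG (g : ℕ → ℝ) : Prop :=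
  (∀ n, 0 < g n) ∧ Tendsto g atTop atTop ∧
    ¬ Tendsto (fun n : ℕ => (n : ℝ) / g n) atTop (nhds 0)

/-- The simple density ideal `Z_g`. -/
def Zg (g : ℕ → ℝ) : Set (Set ℕ) :=
  {A | Tendsto (fun n => (cnt A n : ℝ) / g n) atTop (nhds 0)}

/-- `Z_g` for an `ω`-valued function. -/
def ZgN (g : ℕ → ℕ) : Set (Set ℕ) := Zg (fun n => (g n : ℝ))

/-- `H↑` : nondecreasing members of `G` with values in `ω`. -/
def inHup (f : ℕ → ℕ) : Prop := inG (fun n => (f n : ℝ)) ∧ Monotone f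

open scoped ENNReal

/-- The relation `R`: `g R h` iff `limsup g(n)/h(n) < ∞` and `limsup h(n)/g(n) < ∞`. -/
def Rrel (g h : ℕ → ℕ) : Prop :=
  limsup (fun n => (g n : ℝ≥0∞) / (h n : ℝ≥0∞)) atTop < ⊤ ∧
  limsup (fun n => (h n : ℝ≥0∞) / (g n : ℝ≥0∞)) atTop < ⊤

/-- `S_f` : the quotient of `{g ∈ H↑ : Z_f = Z_g}` by the relation `R`. -/
def Sf (f : ℕ → ℕ) : Type :=
  Quot (fun g h : {g : ℕ → ℕ // inHup g ∧ ZgN g = ZgN f} => Rrel g.1 h.1)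

theorem inHup.pos {f : ℕ → ℕ} (hf : inHup f) (n : ℕ) : 0 < f n :=
  Nat.cast_pos.mp (hf.1.1 n)

theorem inHup.tendsto {f : ℕ → ℕ} (hf : inHup f) : Tendsto f atTop atTop :=
  tendsto_natCast_atTop_iff.mp hf.1.2.1

/-- Eventual domination up to a constant factor. -/
def EventuallyDominated (g h : ℕ → ℕ) : Prop := ∃ C : ℕ, ∀ᶠ n in atTop, g n ≤ C * h n

theorem EventuallyDominated.trans {f g h : ℕ → ℕ} (hfg : EventuallyDominated f g)
    (hgh : EventuallyDominated g h) : EventuallyDominated f h := by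
  obtain ⟨C, hC⟩ := hfg
  obtain ⟨D, hD⟩ := hgh
  refine ⟨C * D, ?_⟩
  filter_upwards [hC, hD] with n h1 h2
  calc f n ≤ C * g n := h1
    _ ≤ C * (D * h n) := Nat.mul_le_mul_left _ h2
    _ = C * D * h n := by ring

theorem limsup_div_lt_top_iff {g h : ℕ → ℕ} (hh : ∀ n, 0 < h n) :
    limsup (fun n => (g n : ℝ≥0∞) / (h n : ℝ≥0∞)) atTop < ⊤ ↔ EventuallyDominated g h := by
  have key : ∀ n (C : ℕ), (g n : ℝ≥0∞) / (h n : ℝ≥0∞) ≤ C ↔ g n ≤ C * h n := by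
    intro n C
    rw [ENNReal.div_le_iff (by exact_mod_cast (hh n).ne') (ENNReal.natCast_ne_top _)]
    exact_mod_cast Iff.rfl
  constructor
  · intro hlt
    obtain ⟨C, hC⟩ := ENNReal.exists_nat_gt hlt.ne
    refine ⟨C, ?_⟩
    filter_upwards [eventually_lt_of_limsup_lt hC] with n hn
    exact (key n C).mp hn.le
  · rintro ⟨C, hC⟩
    refine lt_of_le_of_lt (limsup_le_of_le (a := (C : ℝ≥0∞)) (h := ?_))
      (ENNReal.natCast_lt_top C)
    filter_upwards [hC] with n hn
    exact (key n C).mpr hn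

theorem Rrel_iff {g h : ℕ → ℕ} (hg : ∀ n, 0 < g n) (hh : ∀ n, 0 < h n) :
    Rrel g h ↔ EventuallyDominated g h ∧ EventuallyDominated h g :=
  and_congr (limsup_div_lt_top_iff hh) (limsup_div_lt_top_iff hg)

theorem card_Sf_eq_one_iff_forall {f : ℕ → ℕ} (hf : inHup f) :
    Cardinal.mk (Sf f) = 1 ↔ ∀ g, inHup g → ZgN g = ZgN f →
      EventuallyDominated g f ∧ EventuallyDominated f g := by
  have hequiv : Equivalence
      (fun g h : {g : ℕ → ℕ // inHup g ∧ ZgN g = ZgN f} => Rrel g.1 h.1) := by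
    refine ⟨fun g => ?_, fun h => h.symm, fun {a b c} h1 h2 => ?_⟩
    · rw [Rrel_iff g.2.1.pos g.2.1.pos, and_self]
      exact ⟨1, Eventually.of_forall fun n => by simp⟩
    · rw [Rrel_iff a.2.1.pos b.2.1.pos] at h1
      rw [Rrel_iff b.2.1.pos c.2.1.pos] at h2
      rw [Rrel_iff a.2.1.pos c.2.1.pos]
      exact ⟨h1.1.trans h2.1, h2.2.trans h1.2⟩
  rw [Cardinal.eq_one_iff_unique]
  constructor
  · rintro ⟨hs, -⟩ g hg hgf
    rw [← Rrel_iff hg.pos hf.pos]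
    exact (hequiv.quot_mk_eq_iff ⟨g, hg, hgf⟩ ⟨f, hf, rfl⟩).mp (hs.elim _ _)
  · intro h
    refine ⟨⟨fun x y => ?_⟩, ⟨Quot.mk _ ⟨f, hf, rfl⟩⟩⟩
    induction x using Quot.ind with | _ x
    induction y using Quot.ind with | _ y
    refine Quot.sound ?_
    rw [Rrel_iff x.2.1.pos y.2.1.pos]
    have hx := h x.1 x.2.1 x.2.2
    have hy := h y.1 y.2.1 y.2.2
    exact ⟨hx.1.trans hy.2, hy.1.trans hx.2⟩

theorem mem_ZgN_iff {g : ℕ → ℕ} (hg : ∀ n, 0 < g n) (A : Set ℕ) :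
    A ∈ ZgN g ↔ ∀ k : ℕ, ∀ᶠ n in atTop, k * cnt A n ≤ g n := by
  have hg' : ∀ n, (0 : ℝ) < g n := fun n => Nat.cast_pos.mpr (hg n)
  change Tendsto (fun n => (cnt A n : ℝ) / (g n : ℝ)) atTop (nhds 0) ↔ _
  constructor
  · intro h k
    have hk : (0 : ℝ) < 1 / (k + 1) := by positivity
    filter_upwards [h.eventually_lt_const hk] with n hn
    rw [div_lt_div_iff₀ (hg' n) (by positivity)] at hn
    have : cnt A n * (k + 1) < 1 * g n := by exact_mod_cast hn
    nlinarith
  · intro h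
    rw [Metric.tendsto_atTop']
    intro ε hε
    obtain ⟨k, hk⟩ := exists_nat_gt (1 / ε)
    obtain ⟨N, hN⟩ := eventually_atTop.mp (h k)
    refine ⟨N, fun n hn => ?_⟩
    have h1 : (k : ℝ) * cnt A n ≤ g n := by exact_mod_cast hN n hn.le
    have hkε : 1 < k * ε := by rwa [div_lt_iff₀ hε] at hk
    rw [Real.dist_eq, sub_zero, abs_of_nonneg (by positivity), div_lt_iff₀ (hg' n)]
    have hk0 : (0 : ℝ) < k := lt_trans (by positivity) hk
    have h2 := hg' n
    have h3 : (k : ℝ) * cnt A n < k * (ε * g n) := by nlinarith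
    exact lt_of_mul_lt_mul_left h3 hk0.le

theorem cnt_mono (A : Set ℕ) : Monotone (cnt A) := fun _ n hmn =>
  Set.ncard_le_ncard (Set.inter_subset_inter_right A (Set.Iio_subset_Iio hmn))
    ((Set.finite_Iio n).inter_of_right A)

theorem cnt_le_add_sub (A : Set ℕ) (m n : ℕ) : cnt A n ≤ cnt A m + (n - m) := by
  have h : A ∩ Set.Iio n ⊆ (A ∩ Set.Iio m) ∪ Set.Ico m n := by
    rintro x ⟨hx, hxn⟩
    by_cases hxm : x < m
    · exact Or.inl ⟨hx, hxm⟩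
    · exact Or.inr ⟨not_lt.mp hxm, hxn⟩
  calc cnt A n ≤ ((A ∩ Set.Iio m) ∪ Set.Ico m n).ncard :=
        Set.ncard_le_ncard h (((Set.finite_Iio m).inter_of_right A).union (Set.finite_Ico m n))
    _ ≤ cnt A m + (Set.Ico m n).ncard := Set.ncard_union_le _ _
    _ = cnt A m + (n - m) := by simp [Set.ncard_eq_toFinset_card']

theorem cnt_univ (n : ℕ) : cnt Set.univ n = n := by
  simp [cnt, Set.ncard_eq_toFinset_card']

/-- Long intervals on which `h` is large, ending at points where `g` is small, yield a set
separating `Z_h` from `Z_g`. -/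
theorem exists_mem_ZgN_notMem_ZgN {g h : ℕ → ℕ} (hg : ∀ n, 0 < g n) (hh : ∀ n, 0 < h n)
    (hmono : Monotone h) (C : ℕ)
    (H : ∀ k m, ∃ a b, m ≤ a ∧ a ≤ b ∧ k * m ≤ h a ∧ k * (b - a) ≤ h a ∧
      g b ≤ C * (b - a)) :
    ∃ A, A ∈ ZgN h ∧ A ∉ ZgN g := by
  choose a b hma hab hm hlen hgb using H
  let m : ℕ → ℕ := fun k => Nat.rec 0 (fun k x => b k x + 1) k
  let a' : ℕ → ℕ := fun k => a k (m k)
  let b' : ℕ → ℕ := fun k => b k (m k)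
  have hmsucc : ∀ k, m (k + 1) = b' k + 1 := fun k => rfl
  have hma' : ∀ k, m k ≤ a' k := fun k => hma _ _
  have hab' : ∀ k, a' k ≤ b' k := fun k => hab _ _
  have hm' : ∀ k, k * m k ≤ h (a' k) := fun k => hm _ _
  have hlen' : ∀ k, k * (b' k - a' k) ≤ h (a' k) := fun k => hlen _ _
  have hgb' : ∀ k, g (b' k) ≤ C * (b' k - a' k) := fun k => hgb _ _
  clear_value a' b' m
  have hmstrict : StrictMono m := strictMono_nat_of_lt_succ fun k => by
    have := hma' k; have := hab' k; have := hmsucc k; omega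
  have hastrict : StrictMono a' := strictMono_nat_of_lt_succ fun k => by
    have := hma' (k + 1); have := hab' k; have := hmsucc k; omega
  refine ⟨⋃ k, Set.Ico (a' k) (b' k), ?_, ?_⟩
  · rw [mem_ZgN_iff hh]
    intro K
    filter_upwards [eventually_ge_atTop (a' (2 * K))] with n hn
    have hex : ∃ j, n < a' j := ⟨n + 1, hastrict.id_le (n + 1)⟩
    obtain ⟨k, hkn, hnk⟩ : ∃ k, a' k ≤ n ∧ n < a' (k + 1) := by
      have hpos : Nat.find hex ≠ 0 := fun h0 => by
        have h1 := Nat.find_spec hex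
        rw [h0] at h1
        have := hastrict.monotone (Nat.zero_le (2 * K))
        omega
      obtain ⟨k, hk⟩ := Nat.exists_eq_succ_of_ne_zero hpos
      refine ⟨k, not_lt.mp (Nat.find_min hex (by omega)), ?_⟩
      have := Nat.find_spec hex
      rwa [hk] at this
    have hKk : 2 * K ≤ k := by
      have := hastrict.lt_iff_lt.mp (lt_of_le_of_lt hn hnk)
      omega
    have hcnt : cnt (⋃ k, Set.Ico (a' k) (b' k)) n ≤ m k + (b' k - a' k) := by
      have hsub : (⋃ k, Set.Ico (a' k) (b' k)) ∩ Set.Iio n ⊆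
          Set.Iio (m k) ∪ Set.Ico (a' k) (b' k) := by
        rintro x ⟨hx, hxn⟩
        obtain ⟨j, hj⟩ := Set.mem_iUnion.mp hx
        rcases lt_trichotomy j k with hjk | rfl | hjk
        · left
          have h1 := hmstrict.monotone (Nat.succ_le_of_lt hjk)
          have h2 := hmsucc j
          have h3 := hj.2
          simp only [Nat.succ_eq_add_one, Set.mem_Iio] at *
          omega
        · exact Or.inr hj
        · have h1 := hastrict.monotone (Nat.succ_le_of_lt hjk)
          have h2 := hj.1
          simp only [Nat.succ_eq_add_one, Set.mem_Iio] at *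
          omega
      calc _ ≤ (Set.Iio (m k) ∪ Set.Ico (a' k) (b' k)).ncard :=
            Set.ncard_le_ncard hsub ((Set.finite_Iio _).union (Set.finite_Ico _ _))
        _ ≤ (Set.Iio (m k)).ncard + (Set.Ico (a' k) (b' k)).ncard := Set.ncard_union_le _ _
        _ = _ := by simp [Set.ncard_eq_toFinset_card']
    have h1 := hm' k
    have h2 := hlen' k
    have h3 := hmono hkn
    have h4 := Nat.mul_le_mul hKk hcnt
    nlinarith
  · rw [mem_ZgN_iff hg]
    intro hA
    obtain ⟨N, hN⟩ := eventually_atTop.mp (hA (C + 1))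
    have hNb : N ≤ b' N := (hastrict.id_le N).trans (hab' N)
    have h1 := hN (b' N) hNb
    have h2 : b' N - a' N ≤ cnt (⋃ k, Set.Ico (a' k) (b' k)) (b' N) := by
      calc b' N - a' N = (Set.Ico (a' N) (b' N)).ncard := by
            simp [Set.ncard_eq_toFinset_card']
        _ ≤ _ := Set.ncard_le_ncard
            (Set.subset_inter (Set.subset_iUnion (fun k => Set.Ico (a' k) (b' k)) N)
              Set.Ico_subset_Iio_self)
            ((Set.finite_Iio _).inter_of_right _)
    have h3 := hgb' N
    have h4 := hg (b' N)
    have h5 : b' N - a' N ≠ 0 := fun h0 => by simp [h0] at h3; omega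
    have h6 := Nat.mul_le_mul_left (C + 1) h2
    have h7 := Nat.pos_of_ne_zero h5
    nlinarith

theorem eventuallyDominated_of_ZgN_subset {f g : ℕ → ℕ} (hf : inHup f) (hg : inHup g)
    {M q : ℕ} (hq : 0 < q) (hfM : ∀ᶠ n in atTop, f (n + f n / q) ≤ M * f n)
    (hsub : ZgN g ⊆ ZgN f) : EventuallyDominated g f := by
  by_contra hdom
  have hfreq : ∀ C : ℕ, ∃ᶠ n in atTop, C * f n < g n := by
    intro C hC
    exact hdom ⟨C, hC.mono fun n hn => not_lt.mp hn⟩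
  obtain ⟨A, hAg, hAf⟩ := exists_mem_ZgN_notMem_ZgN hf.pos hg.pos hg.2 (M * (2 * q))
    (fun k m => by
      obtain ⟨n, hn, hnM, hmn, hgn, hfn⟩ := ((hfreq k).and_eventually
        (hfM.and ((eventually_ge_atTop m).and ((hg.tendsto.eventually_ge_atTop (k * m)).and
          (hf.tendsto.eventually_ge_atTop q))))).exists
      have hs : f n ≤ 2 * q * (f n / q) := by
        have h1 := Nat.div_add_mod (f n) q
        have h2 := Nat.mod_lt (f n) hq
        have h3 : 0 < f n / q := Nat.div_pos hfn hq
        nlinarith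
      refine ⟨n, n + f n / q, hmn, Nat.le_add_right _ _, hgn, ?_, ?_⟩
      · rw [Nat.add_sub_cancel_left]
        exact (Nat.mul_le_mul_left k (Nat.div_le_self _ _)).trans hn.le
      · rw [Nat.add_sub_cancel_left]
        calc _ ≤ M * f n := hnM
          _ ≤ M * (2 * q * (f n / q)) := Nat.mul_le_mul_left _ hs
          _ = _ := by ring)
  exact hAf (hsub hAg)

theorem eventuallyDominated_of_subset_ZgN {f g : ℕ → ℕ} (hf : inHup f) (hg : inHup g)
    {M q : ℕ} (hq : 0 < q) (hfM : ∀ᶠ n in atTop, f (n + f n / q) ≤ M * f n)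
    (hsub : ZgN f ⊆ ZgN g) : EventuallyDominated f g := by
  by_contra hdom
  have hfreq : ∀ C : ℕ, ∃ᶠ n in atTop, C * g n < f n := by
    intro C hC
    exact hdom ⟨C, hC.mono fun n hn => not_lt.mp hn⟩
  have hM : 0 < M := by
    obtain ⟨n, hn⟩ := hfM.exists
    have := hf.pos (n + f n / q)
    exact Nat.pos_of_ne_zero fun h0 => by simp [h0] at hn; omega
  obtain ⟨A, hAf, hAg⟩ := exists_mem_ZgN_notMem_ZgN hg.pos hf.pos hf.2 1
    (fun k m => by
      obtain ⟨N, hN⟩ := eventually_atTop.mp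
        (hfM.and ((eventually_ge_atTop m).and (hf.tendsto.eventually_ge_atTop q)))
      let K := M * (2 * q) + k + 1
      obtain ⟨n, hn, hgn⟩ := ((hfreq (M * K)).and_eventually
        (hg.tendsto.eventually_ge_atTop (f N + k * m + 1))).exists
      have hgK : g n ≤ K * g n := Nat.le_mul_of_pos_left _ (Nat.succ_pos _)
      have hex : ∃ t, K * g n ≤ f t :=
        ⟨n, by nlinarith⟩
      obtain ⟨p, hNp, hp, hp1⟩ : ∃ p, N ≤ p ∧ f p < K * g n ∧ K * g n ≤ f (p + 1) := by
        have hspec := Nat.find_spec hex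
        have hlt : N < Nat.find hex := by
          by_contra hcon
          have := hf.2 (not_lt.mp hcon)
          omega
        obtain ⟨p, hp⟩ := Nat.exists_eq_succ_of_ne_zero (Nat.ne_zero_of_lt hlt)
        rw [hp] at hspec hlt
        exact ⟨p, Nat.lt_succ_iff.mp hlt, not_le.mp (Nat.find_min hex (by omega)), hspec⟩
      obtain ⟨hpM, hmp, hpq⟩ := hN p hNp
      have hlen : p + f p / q < n := by
        by_contra hcon
        have h1 := hf.2 (not_lt.mp hcon)
        have h2 := Nat.mul_lt_mul_of_pos_left hp hM
        nlinarith
      have hs : 0 < f p / q := Nat.div_pos hpq hq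
      have h1 : K * g n ≤ M * f p :=
        (hp1.trans (hf.2 (Nat.add_le_add_left hs p))).trans hpM
      have h2 : g n * (2 * q) ≤ f p := by
        refine Nat.le_of_mul_le_mul_left (le_trans ?_ h1) hM
        simp only [K]
        nlinarith [Nat.zero_le (k * g n)]
      have h3 : 2 * g n ≤ f p / q := by
        rw [Nat.le_div_iff_mul_le hq]
        linarith
      have hg0 := hg.pos n
      have hpa : p + 1 ≤ n - g n := by omega
      have h4 : K * g n ≤ f (n - g n) := hp1.trans (hf.2 hpa)
      have h5 : n - (n - g n) = g n := by omega
      refine ⟨n - g n, n, by omega, Nat.sub_le _ _, by omega, ?_, ?_⟩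
      · rw [h5]
        refine le_trans (Nat.mul_le_mul_right _ ?_) h4
        simp only [K]; omega
      · rw [h5, one_mul])
  exact hAg (hsub hAf)

theorem exists_ZgN_eq_not_eventuallyDominated {f : ℕ → ℕ} (hf : inHup f)
    (H : ∀ k N, ∃ n s, N ≤ n ∧ (k + 1) * s ≤ f n ∧ k * f n < f (n + s)) :
    ∃ g, inHup g ∧ ZgN g = ZgN f ∧ ¬ EventuallyDominated g f := by
  choose F S hF hS hjump using H
  let x : ℕ → ℕ := fun k => Nat.rec 0 (fun k x => F k x + S k x + 1) k
  let u : ℕ → ℕ := fun k => F k (x k)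
  let s : ℕ → ℕ := fun k => S k (x k)
  have hxsucc : ∀ k, x (k + 1) = u k + s k + 1 := fun k => rfl
  have hxu : ∀ k, x k ≤ u k := fun k => hF _ _
  have hs : ∀ k, (k + 1) * s k ≤ f (u k) := fun k => hS _ _
  have hju : ∀ k, k * f (u k) < f (u k + s k) := fun k => hjump _ _
  clear_value x u s
  have hustep : ∀ k, u k + s k < u (k + 1) := fun k => by
    have := hxu (k + 1); have := hxsucc k; omega
  have hu : StrictMono u := strictMono_nat_of_lt_succ fun k => by
    have := hustep k; omega
  have hus : ∀ i j, i < j → u i + s i < u j := fun i j hij =>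
    (hustep i).trans_le (hu.monotone hij)
  let I : ℕ → Finset ℕ := fun n => (Finset.range (n + 1)).filter (fun k => u k ≤ n)
  have hI : ∀ n k, k ∈ I n ↔ u k ≤ n := fun n k => by
    have := hu.id_le k
    simp only [I, Finset.mem_filter, Finset.mem_range, id] at *
    omega
  let g : ℕ → ℕ := fun n => f n ⊔ (I n).sup (fun k => f (u k + s k))
  have hfg : ∀ n, f n ≤ g n := fun n => le_sup_left
  have hgmono : Monotone g := fun a b hab =>
    sup_le_sup (hf.2 hab) (Finset.sup_mono fun k hk => by
      rw [hI] at hk ⊢; exact hk.trans hab)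
  have hgeq : ∀ n, (∀ k, u k ≤ n → u k + s k ≤ n) → g n = f n := fun n hn =>
    sup_eq_left.mpr (Finset.sup_le fun k hk => hf.2 (hn k ((hI n k).mp hk)))
  have hgu : ∀ k, f (u k + s k) ≤ g (u k) := fun k =>
    (Finset.le_sup (f := fun k => f (u k + s k)) ((hI _ k).mpr le_rfl)).trans le_sup_right
  have hgpos : ∀ n, 0 < g n := fun n => (hf.pos n).trans_le (hfg n)
  clear_value g
  have hZ : ZgN g = ZgN f := by
    ext A
    rw [mem_ZgN_iff hgpos, mem_ZgN_iff hf.pos]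
    constructor
    · intro hA k
      obtain ⟨N, hN⟩ := eventually_atTop.mp (hA (3 * k + 1))
      let J := N + 1 + 3 * k
      filter_upwards [eventually_ge_atTop (u J + s J), eventually_ge_atTop N,
        hf.tendsto.eventually_ge_atTop (3 * k)] with n hnJ hnN hfn
      by_cases hn : ∀ j, u j ≤ n → u j + s j ≤ n
      · have h1 := hN n hnN
        rw [hgeq n hn] at h1
        nlinarith
      · push Not at hn
        obtain ⟨j, huj, hnj⟩ := hn
        have hjJ : J < j := by
          by_contra hcon
          rcases (not_lt.mp hcon).eq_or_lt with rfl | hlt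
          · omega
          · have := hus j J hlt; omega
        have hju' : j ≤ u j := hu.id_le j
        have hp : g (u j - 1) = f (u j - 1) := hgeq _ fun i hi => by
          have : i < j := hu.lt_iff_lt.mp (by omega)
          have := hus i j this
          omega
        have h1 := hN (u j - 1) (by omega)
        rw [hp] at h1
        have h2 := cnt_le_add_sub A (u j - 1) n
        have h3 : n - (u j - 1) ≤ s j + 1 := by omega
        have h4 := hf.2 (show u j - 1 ≤ n by omega)
        have h5 := hf.2 huj
        have h6 := hs j
        have h7 : 3 * k * s j ≤ (j + 1) * s j := Nat.mul_le_mul_right _ (by omega)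
        have h8 : k * cnt A n ≤ k * (cnt A (u j - 1) + (s j + 1)) :=
          Nat.mul_le_mul_left k (by omega)
        nlinarith
    · intro hA k
      filter_upwards [hA k] with n hn
      exact hn.trans (hfg n)
  refine ⟨g, ⟨⟨fun n => Nat.cast_pos.mpr (hgpos n), ?_, ?_⟩, hgmono⟩, hZ, ?_⟩
  · exact tendsto_natCast_atTop_iff.mpr (tendsto_atTop_mono hfg hf.tendsto)
  · intro hlim
    have huniv : Set.univ ∈ ZgN g := by
      change Tendsto (fun n => (cnt Set.univ n : ℝ) / (g n : ℝ)) atTop (nhds 0)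
      simpa only [cnt_univ] using hlim
    rw [hZ] at huniv
    refine hf.1.2.2 ?_
    change Tendsto (fun n => (cnt Set.univ n : ℝ) / (f n : ℝ)) atTop (nhds 0) at huniv
    simpa only [cnt_univ] using huniv
  · rintro ⟨C, hC⟩
    obtain ⟨N, hN⟩ := eventually_atTop.mp hC
    let k := N + C
    have h1 := hN (u k) (le_trans (Nat.le_add_right N C) (hu.id_le k))
    have h2 := hgu k
    have h3 := hju k
    have h4 : C * f (u k) ≤ k * f (u k) := Nat.mul_le_mul_right _ (Nat.le_add_left C N)
    omega

/-- `S_f` has exactly one element iff there are `M > 0` and `ε > 0` such that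
`f(n + ⌊ε·f(n)⌋)/f(n) ≤ M` for all but finitely many `n`. -/
theorem card_Sf_eq_one_iff (f : ℕ → ℕ) (hf : inHup f) :
    Cardinal.mk (Sf f) = 1 ↔
      ∃ M : ℝ, 0 < M ∧ ∃ ε : ℝ, 0 < ε ∧
        ∀ᶠ n in atTop, (f (n + ⌊ε * (f n : ℝ)⌋₊) : ℝ) / (f n : ℝ) ≤ M := by
  rw [card_Sf_eq_one_iff_forall hf]
  constructor
  · intro hall
    by_contra hcon
    obtain ⟨g, hg, hgf, hdom⟩ := exists_ZgN_eq_not_eventuallyDominated hf fun k N => by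
      have hfreq : ∃ᶠ n in atTop,
          ¬ (f (n + ⌊1 / ((k : ℝ) + 1) * (f n : ℝ)⌋₊) : ℝ) / (f n : ℝ) ≤ (k : ℝ) + 1 :=
        fun h => hcon ⟨k + 1, by positivity, 1 / ((k : ℝ) + 1), by positivity,
          h.mono fun n hn => not_not.mp hn⟩
      obtain ⟨n, hn, hNn⟩ := (hfreq.and_eventually (eventually_ge_atTop N)).exists
      refine ⟨n, ⌊1 / ((k : ℝ) + 1) * (f n : ℝ)⌋₊, hNn, ?_, ?_⟩
      · have h1 := Nat.floor_le (show 0 ≤ 1 / ((k : ℝ) + 1) * (f n : ℝ) by positivity)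
        rw [one_div_mul_eq_div, le_div_iff₀ (by positivity)] at h1
        rw [one_div_mul_eq_div, mul_comm]
        exact_mod_cast h1
      · have hpos : (0 : ℝ) < f n := Nat.cast_pos.mpr (hf.pos n)
        rw [not_le, lt_div_iff₀ hpos] at hn
        have h2 : (k : ℝ) * f n < (f (n + ⌊1 / ((k : ℝ) + 1) * (f n : ℝ)⌋₊) : ℝ) := by
          nlinarith
        exact_mod_cast h2
    exact hdom (hall g hg hgf).1
  · rintro ⟨M, -, ε, hε, hM⟩
    obtain ⟨M', hM'⟩ := exists_nat_ge M
    obtain ⟨q, hq⟩ := exists_nat_gt (1 / ε)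
    have hq0 : (0 : ℝ) < q := lt_trans (by positivity) hq
    have hfM : ∀ᶠ n in atTop, f (n + f n / q) ≤ M' * f n := by
      filter_upwards [hM] with n hn
      have hpos : (0 : ℝ) < f n := Nat.cast_pos.mpr (hf.pos n)
      have hfloor : f n / q ≤ ⌊ε * (f n : ℝ)⌋₊ := by
        refine Nat.le_floor (Nat.cast_div_le.trans ?_)
        rw [div_lt_iff₀ hε] at hq
        rw [div_le_iff₀ hq0]
        nlinarith
      refine (hf.2 (Nat.add_le_add_left hfloor n)).trans ?_
      rw [div_le_iff₀ hpos] at hn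
      have h1 := hn.trans (mul_le_mul_of_nonneg_right hM' hpos.le)
      exact_mod_cast h1
    intro g hg hgf
    have hq' : 0 < q := Nat.cast_pos.mp hq0
    exact ⟨eventuallyDominated_of_ZgN_subset hf hg hq' hfM hgf.subset,
      eventuallyDominated_of_subset_ZgN hf hg hq' hfM hgf.superset⟩
end

section
/- There exists a family F ⊆ H of cardinality 𝔠 such that for any two distinct f, g ∈ F, the ideals Z_f and Z_g are not isomorphic; i.e., there are 𝔠 many pairwise non-isomorphic simple density ideals. -/
open Filter

/-- `H = G ∩ ω^ω`. -/
def inH (f : ℕ → ℕ) : Prop := inG (fun n => (f n : ℝ))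

/-- Isomorphism of ideals on `ω`. -/
def IsoIdeals (I J : Set (Set ℕ)) : Prop :=
  ∃ φ : ℕ → ℕ, Function.Bijective φ ∧ ∀ A : Set ℕ, A ∈ I ↔ φ ⁻¹' A ∈ J

/-- The index `k` of the block `[2 ^ k ^ 2, 2 ^ (k + 1) ^ 2)` containing `n`. -/
def blockIndex (n : ℕ) : ℕ := Nat.sqrt (Nat.log 2 n)

theorem lt_two_pow_blockIndex (n : ℕ) : n < 2 ^ (blockIndex n + 1) ^ 2 := by
  refine Nat.lt_pow_of_log_lt (by norm_num) ?_
  rw [pow_two]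
  exact Nat.lt_succ_sqrt _

theorem blockIndex_eq {n k : ℕ} (h₁ : 2 ^ k ^ 2 ≤ n) (h₂ : n < 2 ^ (k + 1) ^ 2) :
    blockIndex n = k := by
  have hn : n ≠ 0 := (lt_of_lt_of_le (by positivity) h₁).ne'
  refine le_antisymm ?_ ?_
  · have := Nat.log_lt_of_lt_pow hn h₂
    exact Nat.lt_succ_iff.1 (Nat.sqrt_lt'.2 this)
  · exact Nat.le_sqrt'.2 (Nat.le_log_of_pow_le (by norm_num) h₁)

theorem tendsto_blockIndex : Tendsto blockIndex atTop atTop := by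
  refine tendsto_atTop.2 fun m => eventually_atTop.2 ⟨2 ^ m ^ 2, fun n hn => ?_⟩
  exact Nat.le_sqrt'.2 (Nat.le_log_of_pow_le (by norm_num) hn)

open Classical in
/-- A step function, constant on each block, smaller on the blocks with index in `S`. -/
noncomputable def stepFun (S : Set ℕ) (n : ℕ) : ℕ :=
  if blockIndex n ∈ S then (blockIndex n + 1) * 2 ^ blockIndex n ^ 2
  else (blockIndex n + 1) ^ 2 * 2 ^ blockIndex n ^ 2

theorem le_stepFun (S : Set ℕ) (n : ℕ) :
    (blockIndex n + 1) * 2 ^ blockIndex n ^ 2 ≤ stepFun S n := by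
  unfold stepFun
  split_ifs
  · exact le_rfl
  · gcongr
    exact Nat.le_self_pow (by norm_num) _

theorem stepFun_le (S : Set ℕ) (n : ℕ) :
    stepFun S n ≤ (blockIndex n + 1) ^ 2 * 2 ^ blockIndex n ^ 2 := by
  unfold stepFun
  split_ifs
  · gcongr
    exact Nat.le_self_pow (by norm_num) _
  · exact le_rfl

theorem blockIndex_lt_stepFun (S : Set ℕ) (n : ℕ) : blockIndex n < stepFun S n :=
  lt_of_lt_of_le (Nat.lt_succ_self _)
    ((Nat.le_mul_of_pos_right _ (by positivity)).trans (le_stepFun S n))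

theorem stepFun_pos (S : Set ℕ) (n : ℕ) : 0 < stepFun S n :=
  (Nat.zero_le _).trans_lt (blockIndex_lt_stepFun S n)

theorem succ_mul_two_pow_le (k : ℕ) : (k + 1) * 2 ^ k ^ 2 ≤ 2 ^ (k ^ 2 + k) := by
  rw [pow_add, mul_comm]
  gcongr
  exact Nat.lt_two_pow_self

theorem inH_stepFun (S : Set ℕ) : inH (stepFun S) := by
  refine ⟨fun n => Nat.cast_pos.2 (stepFun_pos S n), ?_, fun h => ?_⟩
  · exact tendsto_natCast_atTop_atTop.comp
      (tendsto_atTop_mono (fun n => (blockIndex_lt_stepFun S n).le) tendsto_blockIndex)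
  · obtain ⟨N, hN⟩ := eventually_atTop.1 (h.eventually (gt_mem_nhds one_pos))
    set n := 2 ^ (N ^ 2 + 2 * N) with hn
    have hb : blockIndex n = N :=
      blockIndex_eq (Nat.pow_le_pow_right (by norm_num) (by omega))
        (Nat.pow_lt_pow_right (by norm_num) (by ring_nf; omega))
    have hle : stepFun S n ≤ n := by
      refine (stepFun_le S n).trans ?_
      rw [hb, hn, pow_add, mul_comm, mul_comm 2 N, pow_mul 2 N 2]
      gcongr
      exact Nat.lt_two_pow_self
    have hNn : N ≤ n := by
      refine Nat.lt_two_pow_self.le.trans (Nat.pow_le_pow_right (by norm_num) ?_)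
      nlinarith
    have hpos : (0 : ℝ) < stepFun S n := Nat.cast_pos.2 (stepFun_pos S n)
    have := hN n hNn
    rw [div_lt_one hpos] at this
    exact absurd (Nat.cast_lt.1 this) hle.not_gt

/-- Bounding `cnt` by the size of an interval containing the image of the counted points. -/
theorem cnt_preimage_le {φ : ℕ → ℕ} (hφ : Function.Injective φ) {A : Set ℕ} {n m : ℕ}
    (h : ∀ y < n, φ y ∈ A → φ y < m) : cnt (φ ⁻¹' A) n ≤ m := by
  have := Set.ncard_le_ncard_of_injOn (s := φ ⁻¹' A ∩ Set.Iio n) (t := Set.Iio m) φ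
    (fun y hy => h y hy.2 hy.1) hφ.injOn (Set.finite_Iio m)
  simpa [cnt] using this

/-- If every point below `n` outside `A` is the image of a point below `m`, then `A` has at least
`n - m` elements below `n`. -/
theorem le_cnt_add {φ : ℕ → ℕ} {A : Set ℕ} {n m : ℕ}
    (h : ∀ x < n, x ∉ A → x ∈ φ '' Set.Iio m) : n ≤ cnt A n + m := by
  have h₁ : Set.Iio n ⊆ (A ∩ Set.Iio n) ∪ φ '' Set.Iio m := fun x hx => by
    by_cases hA : x ∈ A
    · exact Or.inl ⟨hA, hx⟩
    · exact Or.inr (h x hx hA)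
  have h₂ := Set.ncard_le_ncard h₁
    (((Set.finite_Iio n).inter_of_right A).union ((Set.finite_Iio m).image φ))
  have h₃ := Set.ncard_union_le (A ∩ Set.Iio n) (φ '' Set.Iio m)
  have h₄ := Set.ncard_image_le (f := φ) (Set.finite_Iio m)
  simp only [Set.ncard_Iio_nat] at h₂ h₄
  unfold cnt
  omega

theorem not_isoIdeals_stepFun {S T : Set ℕ} (hST : (S \ T).Infinite) :
    ¬ IsoIdeals (ZgN (stepFun S)) (ZgN (stepFun T)) := by
  rintro ⟨φ, hφ, hiff⟩
  set A : Set ℕ := {x | ∃ k ∈ S \ T, x < (k + 1) * 2 ^ k ^ 2 ∧ ∃ y, φ y = x ∧ 2 ^ k ^ 2 ≤ y}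
  have hmem : φ ⁻¹' A ∈ ZgN (stepFun T) := by
    have hbound : ∀ n, (cnt (φ ⁻¹' A) n : ℝ) / stepFun T n ≤ 1 / ((blockIndex n : ℝ) + 1) := by
      intro n
      have hindex : ∀ y < n, ∀ k, 2 ^ k ^ 2 ≤ y → k ≤ blockIndex n := by
        intro y hy k hk
        have h := (hk.trans_lt hy).trans (lt_two_pow_blockIndex n)
        have h' := (Nat.pow_lt_pow_iff_right (by norm_num)).1 h
        exact Nat.lt_succ_iff.1 (lt_of_pow_lt_pow_left₀ 2 (Nat.zero_le _) h')
      have hnat : cnt (φ ⁻¹' A) n * (blockIndex n + 1) ≤ stepFun T n := by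
        by_cases hl : blockIndex n ∈ S \ T
        · have hc : cnt (φ ⁻¹' A) n ≤ (blockIndex n + 1) * 2 ^ blockIndex n ^ 2 := by
            refine cnt_preimage_le hφ.injective ?_
            rintro y hy ⟨k, -, hlt, y', hy', hk⟩
            obtain rfl := hφ.injective hy'
            have := hindex _ hy k hk
            refine hlt.trans_le ?_
            gcongr
            norm_num
          rw [stepFun, if_neg hl.2]
          nlinarith
        · have hc : cnt (φ ⁻¹' A) n ≤ 2 ^ blockIndex n ^ 2 := by
            refine cnt_preimage_le hφ.injective ?_
            rintro y hy ⟨k, hkS, hlt, y', hy', hk⟩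
            obtain rfl := hφ.injective hy'
            have hne : k ≠ blockIndex n := fun h => hl (h ▸ hkS)
            have hkl := lt_of_le_of_ne (hindex _ hy k hk) hne
            refine hlt.trans_le ((succ_mul_two_pow_le k).trans ?_)
            exact Nat.pow_le_pow_right (by norm_num) (by nlinarith)
          refine le_trans ?_ (le_stepFun T n)
          rw [mul_comm]
          gcongr
      rw [div_le_div_iff₀ (Nat.cast_pos.2 (stepFun_pos T n)) (by positivity), one_mul]
      exact_mod_cast hnat
    exact squeeze_zero (fun n => by positivity) hbound
      (tendsto_one_div_add_atTop_nhds_zero_nat.comp tendsto_blockIndex)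
  have hlim : Tendsto (fun n => (cnt A n : ℝ) / stepFun S n) atTop (nhds 0) := (hiff A).2 hmem
  obtain ⟨N, hN⟩ := eventually_atTop.1 (hlim.eventually (gt_mem_nhds (one_half_pos (α := ℝ))))
  obtain ⟨k, hk, hNk⟩ := hST.exists_gt N
  set n := (k + 1) * 2 ^ k ^ 2 with hn
  have hb : blockIndex n = k :=
    blockIndex_eq (Nat.le_mul_of_pos_left _ (Nat.succ_pos k))
      ((succ_mul_two_pow_le k).trans_lt
        (Nat.pow_lt_pow_right (by norm_num) (by ring_nf; omega)))
  have hf : stepFun S n = n := by rw [stepFun, hb, if_pos hk.1]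
  have hcnt : n ≤ cnt A n + 2 ^ k ^ 2 := by
    refine le_cnt_add (φ := φ) fun x hx hxA => ?_
    obtain ⟨y, rfl⟩ := hφ.surjective x
    refine ⟨y, ?_, rfl⟩
    by_contra hy
    exact hxA ⟨k, hk, hx, y, rfl, not_lt.1 hy⟩
  have hNn : N ≤ n := by
    have : k + 1 ≤ n := Nat.le_mul_of_pos_right _ (by positivity)
    omega
  have hpos : (0 : ℝ) < n := Nat.cast_pos.2 (hf ▸ stepFun_pos S n)
  have hlt := hN n hNn
  rw [hf, div_lt_div_iff₀ hpos two_pos, one_mul] at hlt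
  have hlt' : cnt A n * 2 < n := by exact_mod_cast hlt
  have hk1 : 1 ≤ k := by omega
  have h2 : 2 * 2 ^ k ^ 2 ≤ n := by rw [hn]; gcongr; omega
  omega

/-- A coding of subsets of `ℕ` for which distinct sets have infinite differences of codes. -/
def parityCode (A : Set ℕ) : Set ℕ := {k | (Nat.unpair k).1 ∈ A ↔ Even (Nat.unpair k).2}

theorem infinite_parityCode_diff {A B : Set ℕ} (h : A ≠ B) :
    (parityCode A \ parityCode B).Infinite := by
  obtain ⟨i, hi⟩ : ∃ i, ¬ (i ∈ A ↔ i ∈ B) := by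
    by_contra! hall
    exact h (Set.ext hall)
  by_cases hA : i ∈ A
  · refine Set.infinite_of_injective_forall_mem (f := fun j => Nat.pair i (2 * j))
      (fun a b hab => ?_) fun j => ?_
    · have := (Nat.pair_eq_pair.1 hab).2
      omega
    · simp_all [parityCode]
  · refine Set.infinite_of_injective_forall_mem (f := fun j => Nat.pair i (2 * j + 1))
      (fun a b hab => ?_) fun j => ?_
    · have := (Nat.pair_eq_pair.1 hab).2
      omega
    · simp_all [parityCode]

theorem IsoIdeals.refl (I : Set (Set ℕ)) : IsoIdeals I I :=
  ⟨id, Function.bijective_id, fun _ => Iff.rfl⟩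

/-- There are `𝔠` many pairwise non-isomorphic simple density ideals. -/
theorem continuum_many_nonisomorphic_simple_density_ideals :
    ∃ F : Set (ℕ → ℕ), (∀ f ∈ F, inH f) ∧ Cardinal.mk F = Cardinal.continuum ∧
      ∀ f ∈ F, ∀ g ∈ F, f ≠ g → ¬ IsoIdeals (ZgN f) (ZgN g) := by
  refine ⟨Set.range fun A => stepFun (parityCode A), ?_, ?_, ?_⟩
  · rintro _ ⟨A, rfl⟩
    exact inH_stepFun _
  · rw [Cardinal.mk_range_eq, Cardinal.mk_set_nat]
    intro A B hAB
    by_contra hne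
    refine not_isoIdeals_stepFun (infinite_parityCode_diff hne) ?_
    have hAB' : stepFun (parityCode A) = stepFun (parityCode B) := hAB
    rw [hAB']
    exact IsoIdeals.refl _
  · rintro _ ⟨A, rfl⟩ _ ⟨B, rfl⟩ hne
    exact not_isoIdeals_stepFun (infinite_parityCode_diff fun h => hne (congrArg (fun C => stepFun (parityCode C)) h))
end
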